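/- Let d ≥ 1 and let B be a real symmetric positive semidefinite (d+1)×(d+1) matrix, written in block form B = fromBlocks(b, cᵀ, c, B̂) with b ∈ ℝ, c ∈ ℝ^d, and B̂ the lower-right d×d block. Assume that every x ∈ ℝ^{d+1} with Bx = 0 has first coordinate equal to 0. Then B̂ is positive semidefinite, the kernel of B̂ equals {y ∈ ℝ^d : B(0,y) = 0} (where (0,y) ∈ ℝ^{d+1} denotes the vector with first coordinate 0 and remaining coordinates y), and rank B̂ = rank B − 1. -/

import Mathlib

open Matrix

/-- A vector `v ∈ ℝ^d` regarded as a column matrix. -/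
noncomputable def colV {d : ℕ} (v : Fin d → ℝ) : Matrix (Fin d) Unit ℝ :=
  Matrix.of fun i _ => v i

/-- A vector `v ∈ ℝ^d` regarded as a row matrix. -/
noncomputable def rowV {d : ℕ} (v : Fin d → ℝ) : Matrix Unit (Fin d) ℝ :=
  Matrix.of fun _ j => v j

namespace Matrix

/-- A vector `y` is killed by the lower-right block of a positive semidefinite matrix iff its
extension by zero is killed by the whole matrix. -/
theorem PosSemidef.toBlocks₂₂_mulVec_eq_zero_iff {m n : Type*} [Fintype m] [Fintype n]
    {A : Matrix (m ⊕ n) (m ⊕ n) ℝ} (hA : A.PosSemidef) (y : n → ℝ) :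
    A.toBlocks₂₂ *ᵥ y = 0 ↔ A *ᵥ Sum.elim (fun _ => (0 : ℝ)) y = 0 := by
  have hlower (j : n) : (A *ᵥ Sum.elim (fun _ => (0 : ℝ)) y) (Sum.inr j) =
      (A.toBlocks₂₂ *ᵥ y) j := by
    simp [mulVec, dotProduct, toBlocks₂₂]
  constructor
  · intro hy
    rw [← hA.dotProduct_mulVec_zero_iff]
    simp [dotProduct, hlower, hy]
  · intro h
    ext j
    rw [← hlower, h, Pi.zero_apply, Pi.zero_apply]

/-- If the kernel of a positive semidefinite matrix is supported on the second block of
coordinates, then it is isomorphic to the kernel of the lower-right block. -/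
theorem PosSemidef.finrank_ker_toBlocks₂₂ {m n : Type*} [Fintype m] [Fintype n]
    {A : Matrix (m ⊕ n) (m ⊕ n) ℝ} (hA : A.PosSemidef)
    (hker : ∀ x : m ⊕ n → ℝ, A *ᵥ x = 0 → ∀ i, x (Sum.inl i) = 0) :
    Module.finrank ℝ (LinearMap.ker A.toBlocks₂₂.mulVecLin) =
      Module.finrank ℝ (LinearMap.ker A.mulVecLin) := by
  have hext (x : m ⊕ n → ℝ) (hx : A *ᵥ x = 0) :
      Sum.elim (fun _ => (0 : ℝ)) (fun j => x (Sum.inr j)) = x := by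
    ext (i | j)
    · exact (hker x hx i).symm
    · rfl
  refine LinearEquiv.finrank_eq (LinearEquiv.symm
    { toFun := fun x => ⟨fun j => x.1 (Sum.inr j), ?_⟩
      invFun := fun y => ⟨Sum.elim (fun _ => 0) y.1, ?_⟩
      map_add' := fun _ _ => rfl
      map_smul' := fun _ _ => rfl
      left_inv := fun x => Subtype.ext (hext x.1 x.2)
      right_inv := fun _ => rfl })
  · have hx : A *ᵥ x.1 = 0 := x.2
    exact (hA.toBlocks₂₂_mulVec_eq_zero_iff _).2 ((hext x.1 hx).symm ▸ hx)
  · exact (hA.toBlocks₂₂_mulVec_eq_zero_iff y.1).1 y.2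

/-- If the kernel of a positive semidefinite matrix is supported on the second block of
coordinates, then dropping the first block lowers the rank by the size of that block. -/
theorem PosSemidef.rank_toBlocks₂₂_add_card {m n : Type*} [Fintype m] [Fintype n]
    {A : Matrix (m ⊕ n) (m ⊕ n) ℝ} (hA : A.PosSemidef)
    (hker : ∀ x : m ⊕ n → ℝ, A *ᵥ x = 0 → ∀ i, x (Sum.inl i) = 0) :
    A.toBlocks₂₂.rank + Fintype.card m = A.rank := by
  have h₁ := A.mulVecLin.finrank_range_add_finrank_ker
  have h₂ := A.toBlocks₂₂.mulVecLin.finrank_range_add_finrank_ker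
  have h₃ := hA.finrank_ker_toBlocks₂₂ hker
  rw [Module.finrank_fintype_fun_eq_card] at h₁ h₂
  rw [Fintype.card_sum] at h₁
  unfold Matrix.rank
  omega

end Matrix

/-- For a symmetric positive semidefinite `(d+1)×(d+1)` matrix
`B = fromBlocks(b, cᵀ, c, B̂)` such that every kernel vector of `B` has vanishing first
coordinate: `B̂` is positive semidefinite, `ker B̂ = {y : B(0,y) = 0}`, and
`rank B̂ = rank B - 1`. -/
theorem stmt16 {d : ℕ} (hd : 1 ≤ d) (b : ℝ) (c : Fin d → ℝ)
    (Bh : Matrix (Fin d) (Fin d) ℝ)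
    (B : Matrix (Unit ⊕ Fin d) (Unit ⊕ Fin d) ℝ)
    (hB : B = Matrix.fromBlocks (Matrix.of fun _ _ => b) (rowV c) (colV c) Bh)
    (hpsd : B.PosSemidef)
    (hker : ∀ x : (Unit ⊕ Fin d) → ℝ, B *ᵥ x = 0 → x (Sum.inl ()) = 0) :
    Bh.PosSemidef ∧
    (∀ y : Fin d → ℝ, Bh *ᵥ y = 0 ↔ B *ᵥ (Sum.elim (fun _ => (0 : ℝ)) y) = 0) ∧
    Bh.rank = B.rank - 1 := by
  have hblock : B.toBlocks₂₂ = Bh := by rw [hB, toBlocks_fromBlocks₂₂]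
  subst hblock
  refine ⟨hpsd.submatrix Sum.inr, hpsd.toBlocks₂₂_mulVec_eq_zero_iff, ?_⟩
  have hrank := hpsd.rank_toBlocks₂₂_add_card fun x hx _ => hker x hx
  rw [Fintype.card_unit] at hrank
  omega
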